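/- arXiv:2011.11884 — 2 statements merged into one kernel-verified Lean document; each statement's English description precedes it below -/
import Mathlib

section
/- Under assumptions (a)–(c) and the SMG iterates with arbitrary permutations, choose the diminishing learning rate η_t := γ/(t+λ)^{1/3} for some γ > 0 and λ ≥ 0 such that η_1 = γ/(1+λ)^{1/3} ≤ 1/(L·√K), where K := max{5/2, 9(5−3β)(Θ+1)/(1−β)}. Then for every T ≥ 2, (1/Σ_{t=1}^T η_t) · Σ_{t=1}^T η_t·‖∇F(w̃_{t−1})‖² ≤ (C_1 + C_2·log(T−1+λ)) / ((T+λ)^{2/3} − (1+λ)^{2/3}), where C_1 := 4·(F(w̃_0) − F_*)/((1−β)·γ) + 18·σ²·L²·(5−3β)·γ²/((1−β)·(1+λ)) and C_2 := 9·σ²·L²·(5−3β)·γ²/(1−β). -/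
open Finset

lemma norm_sum_sq_le_card_mul {E ι : Type*} [SeminormedAddCommGroup E] (s : Finset ι) (a : ι → E) :
    ‖∑ i ∈ s, a i‖ ^ 2 ≤ #s * ∑ i ∈ s, ‖a i‖ ^ 2 :=
  (pow_le_pow_left₀ (norm_nonneg _) (norm_sum_le s a) 2).trans sq_sum_le_card_mul_sum_sq

lemma norm_add_add_sq_le {E : Type*} [SeminormedAddCommGroup E] (a b c : E) :
    ‖a + b + c‖ ^ 2 ≤ 3 * (‖a‖ ^ 2 + ‖b‖ ^ 2 + ‖c‖ ^ 2) := by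
  have h := pow_le_pow_left₀ (norm_nonneg _) (norm_add₃_le (a := a) (b := b) (c := c)) 2
  nlinarith [sq_nonneg (‖a‖ - ‖b‖), sq_nonneg (‖b‖ - ‖c‖), sq_nonneg (‖a‖ - ‖c‖)]

section InnerProductSpace

variable {E : Type*} [NormedAddCommGroup E] [InnerProductSpace ℝ E]

/-- **Descent lemma** for a function with Lipschitz gradient. -/
lemma le_add_inner_gradient_add_sq [CompleteSpace E] {F : E → ℝ} (hF : Differentiable ℝ F) {L : ℝ}
    (hLip : ∀ x y, ‖gradient F x - gradient F y‖ ≤ L * ‖x - y‖) (x y : E) :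
    F y ≤ F x + inner ℝ (gradient F x) (y - x) + L / 2 * ‖y - x‖ ^ 2 := by
  set u := y - x with hu
  have hline : ∀ s : ℝ, HasDerivAt (fun s : ℝ => F (x + s • u))
      (inner ℝ (gradient F (x + s • u)) u) s := by
    intro s
    have hpath : HasDerivAt (fun s : ℝ => x + s • u) u s := by
      simpa using ((hasDerivAt_id s).smul_const u).const_add x
    have h := (hF (x + s • u)).hasFDerivAt.comp_hasDerivAt s hpath
    rwa [← inner_gradient_left] at h
  have hquad : ∀ s : ℝ, HasDerivAt
      (fun s : ℝ => F x + s * inner ℝ (gradient F x) u + L / 2 * ‖u‖ ^ 2 * s ^ 2)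
      (inner ℝ (gradient F x) u + L * ‖u‖ ^ 2 * s) s := by
    intro s
    have h := (((hasDerivAt_id s).mul_const (inner ℝ (gradient F x) u)).const_add (F x)).add
      (((hasDerivAt_id s).pow 2).const_mul (L / 2 * ‖u‖ ^ 2))
    refine h.congr_deriv ?_
    simp
    ring
  have key := image_le_of_deriv_right_le_deriv_boundary (a := 0) (b := 1)
    (fun s _ => (hline s).continuousAt.continuousWithinAt)
    (fun s _ => (hline s).hasDerivWithinAt) (by simp)
    (fun s _ => (hquad s).continuousAt.continuousWithinAt)
    (fun s _ => (hquad s).hasDerivWithinAt)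
    (fun s hs => by
      have h1 : inner ℝ (gradient F (x + s • u) - gradient F x) u
          ≤ ‖gradient F (x + s • u) - gradient F x‖ * ‖u‖ := real_inner_le_norm _ _
      have h2 := hLip (x + s • u) x
      rw [add_sub_cancel_left, norm_smul, Real.norm_of_nonneg hs.1] at h2
      rw [inner_sub_left] at h1
      nlinarith [mul_le_mul_of_nonneg_right h2 (norm_nonneg u)])
    (Set.right_mem_Icc.2 zero_le_one)
  simpa [hu] using key

/-- Convexity of the squared norm. -/
lemma norm_convex_comb_sq_le {β : ℝ} (hβ0 : 0 ≤ β) (hβ1 : β ≤ 1) (a b : E) :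
    ‖β • a + (1 - β) • b‖ ^ 2 ≤ β * ‖a‖ ^ 2 + (1 - β) * ‖b‖ ^ 2 := by
  have h1 := norm_add_sq_real (β • a) ((1 - β) • b)
  have h2 := norm_sub_sq_real a b
  rw [norm_smul, norm_smul, real_inner_smul_left, real_inner_smul_right,
    Real.norm_of_nonneg hβ0, Real.norm_of_nonneg (sub_nonneg.2 hβ1)] at h1
  have h3 := mul_nonneg (mul_nonneg hβ0 (sub_nonneg.2 hβ1)) (sq_nonneg ‖a - b‖)
  rw [h2] at h3
  linarith

lemma sub_iterate_eq_smul_sum {n : ℕ} {x u : ℕ → E} {c : ℝ}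
    (hx : ∀ i < n, x (i + 1) = x i - c • u i) {i k : ℕ} (hik : i ≤ k) (hk : k ≤ n) :
    x i - x k = c • ∑ j ∈ Ico i k, u j := by
  induction k, hik using Nat.le_induction with
  | base => simp
  | succ k hik ih =>
    rw [hx k hk, sum_Ico_succ_top hik, smul_add, ← ih (by omega)]
    abel

/-- Two iterates of the same epoch differ by at most the step size times the
root mean square of the update directions. -/
lemma norm_sub_iterate_sq_le {n : ℕ} (hn : 1 ≤ n) {x u : ℕ → E} {η : ℝ}
    (hx : ∀ i < n, x (i + 1) = x i - (η / n) • u i) {i k : ℕ} (hi : i ≤ n) (hk : k ≤ n) :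
    ‖x i - x k‖ ^ 2 ≤ η ^ 2 * ((1 / n) * ∑ j ∈ range n, ‖u j‖ ^ 2) := by
  wlog hik : i ≤ k generalizing i k
  · rw [norm_sub_rev]
    exact this hk hi (le_of_not_ge hik)
  have hn0 : (0 : ℝ) < n := by exact_mod_cast hn
  have hcard : ((#(Ico i k) : ℕ) : ℝ) ≤ n := by
    rw [Nat.card_Ico]
    exact_mod_cast (Nat.sub_le k i).trans hk
  have hsum : ∑ j ∈ Ico i k, ‖u j‖ ^ 2 ≤ ∑ j ∈ range n, ‖u j‖ ^ 2 :=
    sum_le_sum_of_subset_of_nonneg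
      (fun j hj => mem_range.2 ((mem_Ico.1 hj).2.trans_le hk)) fun _ _ _ => sq_nonneg _
  have hsum0 : 0 ≤ ∑ j ∈ Ico i k, ‖u j‖ ^ 2 := sum_nonneg fun _ _ => sq_nonneg _
  calc ‖x i - x k‖ ^ 2 = (η / n) ^ 2 * ‖∑ j ∈ Ico i k, u j‖ ^ 2 := by
        rw [sub_iterate_eq_smul_sum hx hik hk, norm_smul, mul_pow, Real.norm_eq_abs, sq_abs]
    _ ≤ (η / n) ^ 2 * (n * ∑ j ∈ range n, ‖u j‖ ^ 2) := by
        gcongr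
        exact (norm_sum_sq_le_card_mul _ _).trans (mul_le_mul hcard hsum hsum0 hn0.le)
    _ = η ^ 2 * ((1 / n) * ∑ j ∈ range n, ‖u j‖ ^ 2) := by
        field_simp

/-- The mean of the stochastic gradients collected along an epoch is close to the full gradient
`μ` at any point `x k` visited in that epoch. -/
lemma norm_sub_epoch_mean_sq_le {n : ℕ} (hn : 1 ≤ n) {G : Fin n → E → E} {L : ℝ}
    (hLip : ∀ i x y, ‖G i x - G i y‖ ≤ L * ‖x - y‖) {x g : ℕ → E} {ρ : Equiv.Perm (Fin n)}
    (hg : ∀ i, ∀ hi : i < n, g i = G (ρ ⟨i, hi⟩) (x i)) {m₀ : E} {β η : ℝ} (hβ0 : 0 ≤ β)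
    (hβ1 : β ≤ 1) (hx : ∀ i < n, x (i + 1) = x i - (η / n) • (β • m₀ + (1 - β) • g i))
    {k : ℕ} (hk : k ≤ n) {μ : E} (hμ : μ = (1 / (n : ℝ)) • ∑ i, G i (x k)) {Θ σ : ℝ} (hΘ : 0 ≤ Θ)
    (hvar : (1 / (n : ℝ)) * ∑ i, ‖G i (x k) - μ‖ ^ 2 ≤ Θ * ‖μ‖ ^ 2 + σ ^ 2)
    (hstep : 45 * (L ^ 2 * η ^ 2) * (Θ + 1) ≤ 1) :
    ‖μ - (n : ℝ)⁻¹ • ∑ i ∈ range n, g i‖ ^ 2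
      ≤ ‖m₀‖ ^ 2 / 42 + ‖μ‖ ^ 2 / 14 + 45 / 14 * (L ^ 2 * η ^ 2 * σ ^ 2) := by
  have hn0 : (0 : ℝ) < n := by exact_mod_cast hn
  set R := (1 / (n : ℝ)) * ∑ i : Fin n, ‖x i - x k‖ ^ 2 with hR
  have hR0 : 0 ≤ R := by positivity
  have hdev : ∀ i : Fin n, ‖g i - G (ρ i) (x k)‖ ^ 2 ≤ L ^ 2 * ‖x i - x k‖ ^ 2 := by
    intro i
    rw [hg i i.2, ← mul_pow]
    exact pow_le_pow_left₀ (norm_nonneg _) (hLip _ _ _) 2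
  have hgrad : (1 / (n : ℝ)) * ∑ i : Fin n, ‖g i‖ ^ 2
      ≤ 3 * (L ^ 2 * R + (Θ + 1) * ‖μ‖ ^ 2 + σ ^ 2) := by
    have h1 : ∀ i : Fin n, ‖g i‖ ^ 2
        ≤ 3 * (L ^ 2 * ‖x i - x k‖ ^ 2 + ‖G (ρ i) (x k) - μ‖ ^ 2 + ‖μ‖ ^ 2) := by
      intro i
      have h := norm_add_add_sq_le (g i - G (ρ i) (x k)) (G (ρ i) (x k) - μ) μ
      rw [sub_add_sub_cancel, sub_add_cancel] at h
      linarith [hdev i]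
    have h2 : ∑ i : Fin n, ‖G (ρ i) (x k) - μ‖ ^ 2 = ∑ i, ‖G i (x k) - μ‖ ^ 2 :=
      Equiv.sum_comp ρ fun i => ‖G i (x k) - μ‖ ^ 2
    calc (1 / (n : ℝ)) * ∑ i : Fin n, ‖g i‖ ^ 2
        ≤ (1 / (n : ℝ)) * ∑ i : Fin n,
          3 * (L ^ 2 * ‖x i - x k‖ ^ 2 + ‖G (ρ i) (x k) - μ‖ ^ 2 + ‖μ‖ ^ 2) := by
          gcongr with i
          exact h1 i
      _ = 3 * (L ^ 2 * R + (1 / (n : ℝ)) * ∑ i, ‖G i (x k) - μ‖ ^ 2 + ‖μ‖ ^ 2) := by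
          rw [← mul_sum, sum_add_distrib, sum_add_distrib, ← mul_sum, h2, hR, sum_const,
            card_univ, Fintype.card_fin, nsmul_eq_mul]
          field_simp
      _ ≤ _ := by linarith
  have hdir : (1 / (n : ℝ)) * ∑ i ∈ range n, ‖β • m₀ + (1 - β) • g i‖ ^ 2
      ≤ β * ‖m₀‖ ^ 2 + (1 - β) * ((1 / (n : ℝ)) * ∑ i : Fin n, ‖g i‖ ^ 2) := by
    calc (1 / (n : ℝ)) * ∑ i ∈ range n, ‖β • m₀ + (1 - β) • g i‖ ^ 2
        ≤ (1 / (n : ℝ)) * ∑ i ∈ range n, (β * ‖m₀‖ ^ 2 + (1 - β) * ‖g i‖ ^ 2) := by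
          gcongr with i
          exact norm_convex_comb_sq_le hβ0 hβ1 _ _
      _ = _ := by
          rw [sum_add_distrib, ← mul_sum, ← mul_sum, sum_const, card_range, nsmul_eq_mul,
            sum_range fun i => ‖g i‖ ^ 2]
          field_simp
  have hRle : R ≤ η ^ 2 * ((1 / n) * ∑ i ∈ range n, ‖β • m₀ + (1 - β) • g i‖ ^ 2) := by
    calc R ≤ (1 / (n : ℝ)) * ∑ _i : Fin n,
          η ^ 2 * ((1 / n) * ∑ i ∈ range n, ‖β • m₀ + (1 - β) • g i‖ ^ 2) := by
          rw [hR]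
          gcongr with i
          exact norm_sub_iterate_sq_le hn hx i.2.le hk
      _ = _ := by
          rw [sum_const, card_univ, Fintype.card_fin, nsmul_eq_mul]
          field_simp
  have hmean : ‖μ - (n : ℝ)⁻¹ • ∑ i ∈ range n, g i‖ ^ 2 ≤ L ^ 2 * R := by
    have h1 : μ - (n : ℝ)⁻¹ • ∑ i ∈ range n, g i
        = -((n : ℝ)⁻¹ • ∑ i : Fin n, (g i - G (ρ i) (x k))) := by
      rw [hμ, sum_sub_distrib, Equiv.sum_comp ρ fun i => G i (x k), sum_range, one_div, smul_sub]
      abel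
    have h2 := norm_sum_sq_le_card_mul univ fun i : Fin n => g i - G (ρ i) (x k)
    rw [card_univ, Fintype.card_fin] at h2
    calc ‖μ - (n : ℝ)⁻¹ • ∑ i ∈ range n, g i‖ ^ 2
        = (n : ℝ)⁻¹ ^ 2 * ‖∑ i : Fin n, (g i - G (ρ i) (x k))‖ ^ 2 := by
          rw [h1, norm_neg, norm_smul, mul_pow, Real.norm_eq_abs, sq_abs]
      _ ≤ (n : ℝ)⁻¹ ^ 2 * (n * ∑ i : Fin n, L ^ 2 * ‖x i - x k‖ ^ 2) := by
          gcongr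
          exact h2.trans (by gcongr with i; exact hdev i)
      _ = L ^ 2 * R := by
          rw [← mul_sum, hR]
          field_simp
  have hc0 : 0 ≤ L ^ 2 * η ^ 2 := by positivity
  have hc : L ^ 2 * η ^ 2 ≤ 1 / 45 := by nlinarith [mul_nonneg hc0 hΘ]
  set S := 3 * (L ^ 2 * R + (Θ + 1) * ‖μ‖ ^ 2 + σ ^ 2) with hS
  have hS0 : 0 ≤ S := by positivity
  have hLR : L ^ 2 * R ≤ L ^ 2 * η ^ 2 * (‖m₀‖ ^ 2 + S) := by
    have h1 : R ≤ η ^ 2 * (‖m₀‖ ^ 2 + S) := by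
      refine hRle.trans ?_
      gcongr
      nlinarith [mul_le_mul_of_nonneg_left hgrad (sub_nonneg.2 hβ1), mul_nonneg hβ0 hS0,
        mul_nonneg (sub_nonneg.2 hβ1) (sq_nonneg ‖m₀‖)]
    nlinarith [mul_le_mul_of_nonneg_left h1 (sq_nonneg L)]
  have h1 : L ^ 2 * η ^ 2 * ‖m₀‖ ^ 2 ≤ 1 / 45 * ‖m₀‖ ^ 2 := by gcongr
  have h2 : L ^ 2 * η ^ 2 * (L ^ 2 * R) ≤ 1 / 45 * (L ^ 2 * R) := by gcongr
  have h3 : L ^ 2 * η ^ 2 * (Θ + 1) * ‖μ‖ ^ 2 ≤ 1 / 45 * ‖μ‖ ^ 2 := by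
    gcongr
    linarith
  rw [hS] at hLR
  linarith

/-- One epoch of momentum descent. -/
lemma momentum_descent [CompleteSpace E] {F : E → ℝ} (hF : Differentiable ℝ F) {L : ℝ}
    (hLip : ∀ x y, ‖gradient F x - gradient F y‖ ≤ L * ‖x - y‖) {β η : ℝ} (hβ0 : 0 ≤ β)
    (hβ1 : β ≤ 1) (hη : 0 ≤ η) (hLη : L * η ≤ 1) (x a b : E) :
    F (x - η • (β • a + (1 - β) • b)) ≤ F x - η / 2 * ‖gradient F x‖ ^ 2
      + η / 2 * (β * ‖gradient F x - a‖ ^ 2 + (1 - β) * ‖gradient F x - b‖ ^ 2) := by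
  set M := β • a + (1 - β) • b with hM
  have h1 := le_add_inner_gradient_add_sq hF hLip x (x - η • M)
  rw [sub_sub_cancel_left, inner_neg_right, norm_neg, norm_smul, real_inner_smul_right,
    mul_pow, Real.norm_eq_abs, sq_abs] at h1
  have h2 := norm_convex_comb_sq_le hβ0 hβ1 (gradient F x - a) (gradient F x - b)
  have h3 : β • (gradient F x - a) + (1 - β) • (gradient F x - b) = gradient F x - M := by
    rw [hM]
    module
  rw [h3, norm_sub_sq_real] at h2
  have h4 := mul_le_mul_of_nonneg_left h2 (by positivity : 0 ≤ η / 2)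
  have h5 := mul_le_mul_of_nonneg_right hLη (mul_nonneg hη (sq_nonneg ‖M‖))
  linarith

end InnerProductSpace

/-- Summed descent of a momentum scheme: `Φ` are the objective values, `G` the squared gradient
norms, `a` the squared momentum norms, and `E`, `D` the squared errors of the old and the new
gradient averages. -/
lemma momentum_potential_bound {Φ G a E D h : ℕ → ℝ} {β c : ℝ} {T : ℕ} (hβ0 : 0 ≤ β) (hβ1 : β ≤ 1)
    (hc : 0 ≤ c) (hG : ∀ t, 0 ≤ G t) (ha : ∀ t, 0 ≤ a t) (hE : ∀ t, 0 ≤ E t) (hD : ∀ t, 0 ≤ D t)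
    (hh : ∀ t, 0 ≤ h t) (hanti : ∀ t, h (t + 1) ≤ h t) (ha0 : a 0 = 0) (hE0 : E 0 = G 0)
    (haGE : ∀ t, a t ≤ 2 * G t + 2 * E t)
    (hΦ : ∀ t < T, Φ (t + 1) ≤ Φ t - h (t + 1) / 2 * G t
      + h (t + 1) / 2 * (β * E t + (1 - β) * D t))
    (hDle : ∀ t < T, D t ≤ a t / 42 + G t / 14 + 45 / 14 * (c * h (t + 1) ^ 2))
    (hEle : ∀ t < T, E (t + 1) ≤ a t / 42 + G (t + 1) / 14 + 45 / 14 * (c * h (t + 1) ^ 2)) :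
    ∀ t < T, Φ (t + 1) + (1 - β) / 4 * ∑ s ∈ range (t + 1), h (s + 1) * G s + h (t + 1) / 60 * a t
      ≤ Φ 0 + 9 / 2 * c * ∑ s ∈ range (t + 1), h s ^ 3 := by
  have hcub : ∀ t, c * h (t + 1) ^ 2 ≤ c * h t ^ 2 := fun t =>
    mul_le_mul_of_nonneg_left (pow_le_pow_left₀ (hh _) (hanti t) 2) hc
  intro t
  induction t with
  | zero =>
    intro ht
    have h1 := hΦ 0 ht
    have hunit : -(1 / 2) * G 0 + 1 / 2 * (β * E 0 + (1 - β) * D 0) + (1 - β) / 4 * G 0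
        ≤ 9 / 2 * (c * h 0 ^ 2) := by
      have h2 := hDle 0 ht
      rw [ha0] at h2
      have h3 : D 0 ≤ G 0 / 14 + 45 / 14 * (c * h 0 ^ 2) := by linarith [hcub 0]
      have h4 := mul_le_mul_of_nonneg_left h3 (sub_nonneg.2 hβ1)
      have h5 : 0 ≤ c * h 0 ^ 2 := mul_nonneg hc (sq_nonneg _)
      rw [hE0]
      nlinarith [mul_nonneg (sub_nonneg.2 hβ1) (hG 0), mul_nonneg hβ0 h5]
    have h6 := mul_le_mul_of_nonneg_left hunit (hh 1)
    have h7 := mul_le_mul_of_nonneg_right (hanti 0) (mul_nonneg hc (sq_nonneg (h 0)))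
    simp only [zero_add, sum_range_one, ha0] at *
    linarith
  | succ t ih =>
    intro ht
    have hprev := ih (by omega)
    have h1 := hΦ (t + 1) ht
    have hunit : -(1 / 2) * G (t + 1) + 1 / 2 * (β * E (t + 1) + (1 - β) * D (t + 1))
        + (1 - β) / 4 * G (t + 1) + 1 / 60 * a (t + 1)
        ≤ 1 / 60 * a t + 9 / 2 * (c * h (t + 1) ^ 2) := by
      have h2 := hDle (t + 1) ht
      have h3 := hEle t (by omega)
      have h4 := haGE (t + 1)
      have h5 : 0 ≤ c * h (t + 1) ^ 2 := mul_nonneg hc (sq_nonneg _)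
      linarith [hcub (t + 1), mul_nonneg hβ0 (hD (t + 1)),
        mul_nonneg (sub_nonneg.2 hβ1) (hE (t + 1)), mul_nonneg hβ0 (hG (t + 1)), ha t, hG (t + 1)]
    have h6 := mul_le_mul_of_nonneg_left hunit (hh (t + 2))
    have h7 := mul_le_mul_of_nonneg_right (hanti (t + 1))
      (mul_nonneg hc (sq_nonneg (h (t + 1))))
    have h8 := mul_le_mul_of_nonneg_right (hanti (t + 1)) (ha t)
    rw [sum_range_succ _ (t + 1), sum_range_succ (fun s => h s ^ 3) (t + 1)]
    rw [show t + 1 + 1 = t + 2 from rfl] at *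
    linarith

lemma rpow_two_thirds_sub_le_sum {lam : ℝ} (hlam : 0 ≤ lam) (T : ℕ) :
    ((T : ℝ) + 1 + lam) ^ ((2 : ℝ) / 3) - (1 + lam) ^ ((2 : ℝ) / 3)
      ≤ ∑ t ∈ range (T + 1), 1 / ((t : ℝ) + 1 + lam) ^ ((1 : ℝ) / 3) := by
  induction T with
  | zero =>
    have : 0 ≤ 1 / (1 + lam) ^ ((1 : ℝ) / 3) := by positivity
    simpa using this
  | succ T ih =>
    rw [sum_range_succ]
    push_cast
    set x : ℝ := (T : ℝ) + 1 + lam with hx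
    have hx0 : 0 < x := by positivity
    rw [show (T : ℝ) + 1 + 1 + lam = x + 1 by rw [hx]; ring]
    have hsplit : ∀ y : ℝ, 0 < y → y ^ ((2 : ℝ) / 3) = y / y ^ ((1 : ℝ) / 3) := by
      intro y hy
      rw [show (2 : ℝ) / 3 = 1 - 1 / 3 by norm_num, Real.rpow_sub hy, Real.rpow_one]
    have hmono : x ^ ((1 : ℝ) / 3) ≤ (x + 1) ^ ((1 : ℝ) / 3) :=
      Real.rpow_le_rpow hx0.le (by linarith) (by norm_num)
    have hdiv : x / (x + 1) ^ ((1 : ℝ) / 3) ≤ x / x ^ ((1 : ℝ) / 3) :=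
      div_le_div_of_nonneg_left hx0.le (by positivity) hmono
    have h1 := hsplit x hx0
    have h2 := hsplit (x + 1) (by linarith)
    rw [add_div] at h2
    linarith

lemma sum_inv_le_log {lam : ℝ} (hlam : 0 ≤ lam) (T : ℕ) :
    ∑ t ∈ range (T + 1), 1 / ((t : ℝ) + 1 + lam) ≤ 1 / (1 + lam) + Real.log ((T : ℝ) + 1 + lam) := by
  induction T with
  | zero => simpa using Real.log_nonneg (by linarith : (1 : ℝ) ≤ 1 + lam)
  | succ T ih =>
    rw [sum_range_succ]
    push_cast
    set x : ℝ := (T : ℝ) + 1 + lam with hx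
    have hx0 : 0 < x := by positivity
    rw [show (T : ℝ) + 1 + 1 + lam = x + 1 by rw [hx]; ring]
    have h := Real.one_sub_inv_le_log_of_pos (x := (x + 1) / x) (by positivity)
    rw [Real.log_div (by positivity) hx0.ne', inv_div] at h
    have h2 : 1 - x / (x + 1) = 1 / (x + 1) := by field_simp; ring
    linarith

theorem smg_diminishing_lr
    (n d : ℕ) (hn : 1 ≤ n) (hd : 1 ≤ d)
    (f : Fin n → EuclideanSpace ℝ (Fin d) → ℝ)
    (hf : ∀ i, Differentiable ℝ (f i))
    (F : EuclideanSpace ℝ (Fin d) → ℝ)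
    (hF : F = fun x => (1 / (n : ℝ)) * ∑ i, f i x)
    (L : ℝ) (hL : 0 < L)
    (hsmooth : ∀ i x y, ‖gradient (f i) x - gradient (f i) y‖ ≤ L * ‖x - y‖)
    (Θ σ : ℝ) (hΘ : 0 ≤ Θ) (hσ : 0 ≤ σ)
    (hvar : ∀ x, (1 / (n : ℝ)) * ∑ i, ‖gradient (f i) x - gradient F x‖ ^ 2
        ≤ Θ * ‖gradient F x‖ ^ 2 + σ ^ 2)
    (Fstar : ℝ) (hFstar : IsGLB (Set.range F) Fstar)
    (T : ℕ) (hT : 1 ≤ T)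
    (β : ℝ) (hβ0 : 0 ≤ β) (hβ1 : β < 1)
    (η : ℕ → ℝ) (hηpos : ∀ t, 1 ≤ t → t ≤ T → 0 < η t)
    (π : ℕ → Equiv.Perm (Fin n))
    (w m v g : ℕ → ℕ → EuclideanSpace ℝ (Fin d))
    (wt mt : ℕ → EuclideanSpace ℝ (Fin d))
    (hmt0 : mt 0 = 0)
    (hw0 : ∀ t, 1 ≤ t → t ≤ T → w t 0 = wt (t - 1))
    (hm0 : ∀ t, 1 ≤ t → t ≤ T → m t 0 = mt (t - 1))
    (hv0 : ∀ t, 1 ≤ t → t ≤ T → v t 0 = 0)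
    (hg : ∀ t, 1 ≤ t → t ≤ T → ∀ i, ∀ hi : i < n,
        g t i = gradient (f (π t ⟨i, hi⟩)) (w t i))
    (hm1 : ∀ t, 1 ≤ t → t ≤ T → ∀ i, i < n →
        m t (i + 1) = β • m t 0 + (1 - β) • g t i)
    (hv1 : ∀ t, 1 ≤ t → t ≤ T → ∀ i, i < n →
        v t (i + 1) = v t i + ((n : ℝ))⁻¹ • g t i)
    (hw1 : ∀ t, 1 ≤ t → t ≤ T → ∀ i, i < n →
        w t (i + 1) = w t i - (η t / (n : ℝ)) • m t (i + 1))
    (hwt : ∀ t, 1 ≤ t → t ≤ T → wt t = w t n)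
    (hmt : ∀ t, 1 ≤ t → t ≤ T → mt t = v t n)
    (K : ℝ) (hKdef : K = max (5 / 2) (9 * (5 - 3 * β) * (Θ + 1) / (1 - β)))
    (γ lam : ℝ) (hγ : 0 < γ) (hlam : 0 ≤ lam)
    (hη0 : η 0 = η 1)
    (hη : ∀ t, 1 ≤ t → η t = γ / ((t : ℝ) + lam) ^ ((1 : ℝ) / 3))
    (hη1K : γ / ((1 : ℝ) + lam) ^ ((1 : ℝ) / 3) ≤ 1 / (L * Real.sqrt K))
    (hT2 : 2 ≤ T) :
    (∑ t ∈ Icc 1 T, η t * ‖gradient F (wt (t - 1))‖ ^ 2) / (∑ t ∈ Icc 1 T, η t)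
      ≤ ((4 * (F (wt 0) - Fstar) / ((1 - β) * γ)
            + 18 * σ ^ 2 * L ^ 2 * (5 - 3 * β) * γ ^ 2 / ((1 - β) * (1 + lam)))
          + 9 * σ ^ 2 * L ^ 2 * (5 - 3 * β) * γ ^ 2 / (1 - β)
            * Real.log ((T : ℝ) - 1 + lam))
        / (((T : ℝ) + lam) ^ ((2 : ℝ) / 3) - ((1 : ℝ) + lam) ^ ((2 : ℝ) / 3)) := by
  have hn0 : (0 : ℝ) < n := by exact_mod_cast hn
  have hq : 0 < 1 - β := by linarith
  have hFgrad : ∀ x, HasGradientAt F ((1 / (n : ℝ)) • ∑ i, gradient (f i) x) x := by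
    intro x
    rw [hasGradientAt_iff_hasFDerivAt, hF]
    have h := (HasFDerivAt.fun_sum (u := univ)
      fun i _ => (hf i x).hasGradientAt.hasFDerivAt).const_mul (1 / (n : ℝ))
    simpa only [map_smul, map_sum] using h
  have hFdiff : Differentiable ℝ F := fun x => (hFgrad x).differentiableAt
  have hgradF : ∀ x, gradient F x = (1 / (n : ℝ)) • ∑ i, gradient (f i) x :=
    fun x => (hFgrad x).gradient
  have hFLip : ∀ x y, ‖gradient F x - gradient F y‖ ≤ L * ‖x - y‖ := by
    intro x y
    rw [hgradF, hgradF, ← smul_sub, ← sum_sub_distrib, norm_smul,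
      Real.norm_of_nonneg (by positivity)]
    calc 1 / (n : ℝ) * ‖∑ i, (gradient (f i) x - gradient (f i) y)‖
        ≤ 1 / (n : ℝ) * ∑ _i : Fin n, L * ‖x - y‖ := by
          gcongr
          exact norm_sum_le_of_le _ fun i _ => hsmooth i x y
      _ = L * ‖x - y‖ := by
          rw [sum_const, card_univ, Fintype.card_fin, nsmul_eq_mul]
          field_simp
  have hηnonneg : ∀ t, 0 ≤ η t := by
    have hsucc : ∀ t, 0 ≤ η (t + 1) := by
      intro t
      rw [hη _ (by omega)]
      positivity
    rintro (_ | t)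
    · exact hη0 ▸ hsucc 0
    · exact hsucc t
  have hηanti : ∀ t, η (t + 1) ≤ η t := by
    rintro (_ | t)
    · exact hη0.ge
    · rw [hη _ (by omega), hη _ (by omega)]
      push_cast
      gcongr
      linarith
  have hηle : ∀ t, η t ≤ η 0 := fun t => antitone_nat_of_succ_le hηanti (Nat.zero_le t)
  have hstep0 : 45 * (L ^ 2 * η 0 ^ 2) * (Θ + 1) ≤ 1 := by
    have hK : 45 * (Θ + 1) ≤ K := by
      refine le_trans ?_ (hKdef ▸ le_max_right _ _)
      rw [le_div_iff₀ hq]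
      nlinarith [mul_nonneg hβ0 hΘ]
    have hK0 : 0 < K := by linarith
    have h1 : L * √K * η 0 ≤ 1 := by
      rw [hη0, hη 1 le_rfl, Nat.cast_one, mul_comm]
      exact (le_div_iff₀ (by positivity)).1 hη1K
    have h2 : (L * √K * η 0) ^ 2 ≤ 1 :=
      pow_le_one₀ (mul_nonneg (by positivity) (hηnonneg 0)) h1
    rw [mul_pow, mul_pow, Real.sq_sqrt hK0.le] at h2
    nlinarith [mul_le_mul_of_nonneg_left hK (by positivity : 0 ≤ L ^ 2 * η 0 ^ 2)]
  have hstep : ∀ t, 45 * (L ^ 2 * η t ^ 2) * (Θ + 1) ≤ 1 := by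
    intro t
    refine le_trans ?_ hstep0
    gcongr
    · exact hηnonneg t
    · exact hηle t
  have hLη : ∀ t, L * η t ≤ 1 := by
    intro t
    have h : (L * η t) ^ 2 ≤ 1 ^ 2 := by
      nlinarith [hstep t, mul_nonneg (by positivity : 0 ≤ L ^ 2 * η t ^ 2) hΘ]
    exact le_of_sq_le_sq h zero_le_one
  have hwstep : ∀ t < T, ∀ i < n, w (t + 1) (i + 1)
      = w (t + 1) i - (η (t + 1) / (n : ℝ)) • (β • mt t + (1 - β) • g (t + 1) i) := by
    intro t ht i hi
    rw [hw1 (t + 1) (by omega) ht i hi, hm1 (t + 1) (by omega) ht i hi, hm0 (t + 1) (by omega) ht,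
      Nat.add_sub_cancel]
  have hmean : ∀ t < T, mt (t + 1) = (n : ℝ)⁻¹ • ∑ i ∈ range n, g (t + 1) i := by
    intro t ht
    have hpartial : ∀ k ≤ n, v (t + 1) k = (n : ℝ)⁻¹ • ∑ i ∈ range k, g (t + 1) i := by
      intro k
      induction k with
      | zero => simp [hv0 (t + 1) (by omega) ht]
      | succ k ih =>
        intro hk
        rw [hv1 (t + 1) (by omega) ht k hk, ih (by omega), sum_range_succ, smul_add]
    rw [hmt (t + 1) (by omega) ht, hpartial n le_rfl]
  have hwtstep : ∀ t < T,
      wt (t + 1) = wt t - η (t + 1) • (β • mt t + (1 - β) • mt (t + 1)) := by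
    intro t ht
    have h := sub_iterate_eq_smul_sum (hwstep t ht) (Nat.zero_le n) le_rfl
    rw [← range_eq_Ico, sum_add_distrib, ← smul_sum, ← smul_sum, sum_const, card_range,
      hw0 (t + 1) (by omega) ht, ← hwt (t + 1) (by omega) ht, Nat.add_sub_cancel,
      ← Nat.cast_smul_eq_nsmul ℝ, sub_eq_iff_eq_add] at h
    rw [hmean t ht, h, eq_sub_iff_add_eq, add_comm]
    congr 1
    simp only [smul_add, smul_smul]
    congr 2 <;> field_simp
  have herr : ∀ t < T, ∀ k ≤ n, ‖gradient F (w (t + 1) k) - mt (t + 1)‖ ^ 2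
      ≤ ‖mt t‖ ^ 2 / 42 + ‖gradient F (w (t + 1) k)‖ ^ 2 / 14
        + 45 / 14 * (L ^ 2 * σ ^ 2 * η (t + 1) ^ 2) := by
    intro t ht k hk
    have h := norm_sub_epoch_mean_sq_le hn hsmooth (hg (t + 1) (by omega) ht) hβ0 hβ1.le
      (hwstep t ht) hk (hgradF _) hΘ (hvar _) (hstep (t + 1))
    rw [← hmean t ht] at h
    linarith
  have hbound := momentum_potential_bound (Φ := fun t => F (wt t))
    (G := fun t => ‖gradient F (wt t)‖ ^ 2) (a := fun t => ‖mt t‖ ^ 2)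
    (E := fun t => ‖gradient F (wt t) - mt t‖ ^ 2)
    (D := fun t => ‖gradient F (wt t) - mt (t + 1)‖ ^ 2) (h := η) (c := L ^ 2 * σ ^ 2) (T := T)
    hβ0 hβ1.le (by positivity) (fun _ => sq_nonneg _) (fun _ => sq_nonneg _)
    (fun _ => sq_nonneg _) (fun _ => sq_nonneg _) hηnonneg hηanti (by simp [hmt0])
    (by simp [hmt0])
    (fun t => by
      have h := norm_sub_le (gradient F (wt t)) (gradient F (wt t) - mt t)
      rw [sub_sub_cancel] at h
      nlinarith [pow_le_pow_left₀ (norm_nonneg _) h 2,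
        sq_nonneg (‖gradient F (wt t)‖ - ‖gradient F (wt t) - mt t‖)])
    (fun t ht => by
      have h := momentum_descent hFdiff hFLip hβ0 hβ1.le (hηnonneg (t + 1)) (hLη (t + 1))
        (wt t) (mt t) (mt (t + 1))
      rwa [← hwtstep t ht] at h)
    (fun t ht => by
      have h := herr t ht 0 (Nat.zero_le n)
      rwa [hw0 (t + 1) (by omega) ht, Nat.add_sub_cancel] at h)
    (fun t ht => by
      have h := herr t ht n le_rfl
      rwa [← hwt (t + 1) (by omega) ht] at h)
  obtain ⟨S, rfl⟩ : ∃ S, T = S + 2 := ⟨T - 2, by omega⟩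
  have hshift : ∀ u : ℕ → ℝ, ∑ t ∈ Icc 1 (S + 2), u t = ∑ t ∈ range (S + 2), u (t + 1) := by
    intro u
    rw [range_eq_Ico, sum_Ico_add' u 0 (S + 2) 1]
    rfl
  have hcube : ∀ t : ℕ, η (t + 1) ^ 3 = γ ^ 3 * (1 / ((t : ℝ) + 1 + lam)) := by
    intro t
    rw [hη _ (by omega), div_pow, ← Real.rpow_natCast (_ ^ _), ← Real.rpow_mul (by positivity)]
    norm_num
    rfl
  have hcubes : ∑ t ∈ range (S + 2), η t ^ 3
      ≤ γ ^ 3 * (2 / (1 + lam) + Real.log ((S : ℝ) + 1 + lam)) := by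
    rw [sum_range_succ', sum_congr rfl fun t _ => hcube t, ← mul_sum, hη0, hcube 0]
    have h := mul_le_mul_of_nonneg_left (sum_inv_le_log hlam S) (by positivity : 0 ≤ γ ^ 3)
    have h2 : 2 / (1 + lam) = 1 / (1 + lam) + 1 / (1 + lam) := by ring
    rw [h2]
    push_cast
    rw [zero_add]
    linarith
  have hsumη : γ * (((S : ℝ) + 2 + lam) ^ ((2 : ℝ) / 3) - (1 + lam) ^ ((2 : ℝ) / 3))
      ≤ ∑ t ∈ range (S + 2), η (t + 1) := by
    have h := mul_le_mul_of_nonneg_left (rpow_two_thirds_sub_le_sum hlam (S + 1)) hγ.le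
    rw [mul_sum] at h
    refine le_trans (le_of_eq ?_) (h.trans (le_of_eq (sum_congr rfl fun t _ => ?_)))
    · push_cast
      ring_nf
    · rw [hη _ (by omega)]
      push_cast
      ring
  have hD : 0 < ((S : ℝ) + 2 + lam) ^ ((2 : ℝ) / 3) - (1 + lam) ^ ((2 : ℝ) / 3) :=
    sub_pos.2 (Real.rpow_lt_rpow (by positivity)
      (by linarith [(Nat.cast_nonneg S : (0 : ℝ) ≤ S)]) (by norm_num))
  have hlow : Fstar ≤ F (wt (S + 2)) := hFstar.1 ⟨_, rfl⟩
  have hlast := hbound (S + 1) (by omega)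
  simp only [Nat.add_assoc, Nat.reduceAdd] at hlast
  rw [hshift, hshift]
  simp only [Nat.add_sub_cancel]
  push_cast
  rw [show (S : ℝ) + 2 - 1 + lam = S + 1 + lam by ring]
  set N := ∑ t ∈ range (S + 2), η (t + 1) * ‖gradient F (wt t)‖ ^ 2 with hN
  have hN0 : 0 ≤ N := sum_nonneg fun t _ => mul_nonneg (hηnonneg _) (sq_nonneg _)
  set ℓ := Real.log ((S : ℝ) + 1 + lam) with hℓ
  set C := (4 * (F (wt 0) - Fstar) / ((1 - β) * γ)
      + 18 * σ ^ 2 * L ^ 2 * (5 - 3 * β) * γ ^ 2 / ((1 - β) * (1 + lam)))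
    + 9 * σ ^ 2 * L ^ 2 * (5 - 3 * β) * γ ^ 2 / (1 - β) * ℓ with hC
  have hNC : N ≤ γ * C := by
    have hCexp : γ * C = 4 / (1 - β) * (F (wt 0) - Fstar
        + 9 / 4 * (5 - 3 * β) * (L ^ 2 * σ ^ 2) * (γ ^ 3 * (2 / (1 + lam) + ℓ))) := by
      rw [hC]
      field_simp
      ring
    have hsum0 : 0 ≤ ∑ t ∈ range (S + 2), η t ^ 3 :=
      sum_nonneg fun t _ => pow_nonneg (hηnonneg t) 3
    have h1 : 9 / 2 * (L ^ 2 * σ ^ 2) * ∑ t ∈ range (S + 2), η t ^ 3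
        ≤ 9 / 4 * (5 - 3 * β) * (L ^ 2 * σ ^ 2) * (γ ^ 3 * (2 / (1 + lam) + ℓ)) := by
      have h5 : 0 ≤ 5 - 3 * β := by linarith
      gcongr
      linarith
    have h2 : 0 ≤ η (S + 2) / 60 * ‖mt (S + 1)‖ ^ 2 := by
      have := hηnonneg (S + 2)
      positivity
    have h3 : (1 - β) / 4 * N ≤ F (wt 0) - Fstar
        + 9 / 4 * (5 - 3 * β) * (L ^ 2 * σ ^ 2) * (γ ^ 3 * (2 / (1 + lam) + ℓ)) := by
      linarith
    rw [hCexp]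
    calc N = 4 / (1 - β) * ((1 - β) / 4 * N) := by field_simp
      _ ≤ _ := by gcongr
  calc N / ∑ t ∈ range (S + 2), η (t + 1)
      ≤ γ * C / (γ * (((S : ℝ) + 2 + lam) ^ ((2 : ℝ) / 3) - (1 + lam) ^ ((2 : ℝ) / 3))) :=
        div_le_div₀ (hN0.trans hNC) hNC (mul_pos hγ hD) hsumη
    _ = _ := mul_div_mul_left _ _ hγ.ne'
end

section
/- Under assumptions (a)–(c) and the SMG iterates with arbitrary permutations, choose the exponential scheduled learning rate η_t := γ·α^t/T^{1/3} where γ > 0, ρ ∈ (0,1), and α := ρ^{1/T} ∈ (0,1), and assume 0 < η_t ≤ 1/(L·√K) for all t ∈ {1,…,T}, where K := max{5/2, 9(5−3β)(Θ+1)/(1−β)}. Then (1/Σ_{t=1}^T η_t) · Σ_{t=1}^T η_t·‖∇F(w̃_{t−1})‖² ≤ 4·(F(w̃_0) − F_*)/((1−β)·γ·ρ·T^{2/3}) + 9·σ²·L²·(5−3β)·γ²/((1−β)·ρ·T^{2/3}). -/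
open Finset

section Descent

variable {E : Type*} [NormedAddCommGroup E] [InnerProductSpace ℝ E] [CompleteSpace E]

/-- The quadratic upper bound for functions with Lipschitz gradient. -/
theorem le_quadratic_of_lipschitz_gradient {F : E → ℝ} {L : ℝ} (hF : Differentiable ℝ F)
    (hL : ∀ x y, ‖gradient F x - gradient F y‖ ≤ L * ‖x - y‖) (x h : E) :
    F (x + h) ≤ F x + inner ℝ (gradient F x) h + L / 2 * ‖h‖ ^ 2 := by
  let φ : ℝ → ℝ := fun s => F (x + s • h) - s * inner ℝ (gradient F x) h - L / 2 * ‖h‖ ^ 2 * s ^ 2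
  have hφ : ∀ s, HasDerivAt φ (inner ℝ (gradient F (x + s • h)) h
      - inner ℝ (gradient F x) h - L * ‖h‖ ^ 2 * s) s := by
    intro s
    have hline : HasDerivAt (fun s : ℝ => x + s • h) h s := by
      simpa using ((hasDerivAt_id s).smul_const h).const_add x
    have hcomp := (hF (x + s • h)).hasGradientAt.hasFDerivAt.comp_hasDerivAt s hline
    have hlin := (hasDerivAt_id s).mul_const (inner ℝ (gradient F x) h)
    have hsq := ((hasDerivAt_id s).pow 2).const_mul (L / 2 * ‖h‖ ^ 2)
    refine ((hcomp.sub hlin).sub hsq).congr_deriv ?_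
    simp
    ring
  have hanti : AntitoneOn φ (Set.Icc 0 1) := by
    refine antitoneOn_of_deriv_nonpos (convex_Icc 0 1)
      (fun s _ => (hφ s).continuousAt.continuousWithinAt)
      (fun s _ => (hφ s).differentiableAt.differentiableWithinAt) ?_
    intro s hs
    rw [interior_Icc] at hs
    rw [(hφ s).deriv, ← inner_sub_left]
    have hcs := real_inner_le_norm (gradient F (x + s • h) - gradient F x) h
    have hlip := hL (x + s • h) x
    rw [add_sub_cancel_left, norm_smul, Real.norm_eq_abs, abs_of_pos hs.1] at hlip
    nlinarith [norm_nonneg h, mul_le_mul_of_nonneg_right hlip (norm_nonneg h)]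
  have h01 := hanti (Set.left_mem_Icc.2 zero_le_one) (Set.right_mem_Icc.2 zero_le_one) zero_le_one
  simp only [φ, one_smul, zero_smul, add_zero] at h01
  linarith

/-- One step `x ↦ x - η • u` along a convex combination `u = β • a + (1 - β) • b`. -/
theorem descent_convex_combination {F : E → ℝ} {L : ℝ} (hF : Differentiable ℝ F)
    (hL : ∀ x y, ‖gradient F x - gradient F y‖ ≤ L * ‖x - y‖)
    {η β : ℝ} (hη : 0 ≤ η) (hβ0 : 0 ≤ β) (hβ1 : β ≤ 1) (x a b u : E)
    (hu : u = β • a + (1 - β) • b) :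
    F (x - η • u) ≤ F x - η / 2 * ‖gradient F x‖ ^ 2 - η / 2 * (1 - L * η) * ‖u‖ ^ 2
      + η / 2 * (β * ‖gradient F x - a‖ ^ 2 + (1 - β) * ‖gradient F x - b‖ ^ 2) := by
  have hquad := le_quadratic_of_lipschitz_gradient hF hL x (-(η • u))
  rw [← sub_eq_add_neg, inner_neg_right, inner_smul_right, norm_neg, norm_smul, mul_pow,
    Real.norm_eq_abs, sq_abs] at hquad
  have hpolar := norm_sub_sq_real (gradient F x) u
  have hjensen : ‖gradient F x - u‖ ^ 2
      ≤ β * ‖gradient F x - a‖ ^ 2 + (1 - β) * ‖gradient F x - b‖ ^ 2 := by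
    have hsplit : gradient F x - u
        = β • (gradient F x - a) + (1 - β) • (gradient F x - b) := by
      rw [hu]; module
    rw [hsplit]
    simpa using (convexOn_univ_norm.pow (fun _ _ => norm_nonneg _) 2).2
      (Set.mem_univ (gradient F x - a)) (Set.mem_univ (gradient F x - b)) hβ0
      (sub_nonneg.2 hβ1) (by ring)
  nlinarith [mul_le_mul_of_nonneg_left hjensen hη]

end Descent

section Averages

variable {E : Type*} [NormedAddCommGroup E] [InnerProductSpace ℝ E]

/-- Jensen's inequality for the squared norm of a partial average. -/
theorem norm_sq_partial_average_le {n i : ℕ} (hn : 1 ≤ n) (hi : i ≤ n) (z : ℕ → E) :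
    ‖(n : ℝ)⁻¹ • ∑ j ∈ range i, z j‖ ^ 2 ≤ (n : ℝ)⁻¹ * ∑ j ∈ range n, ‖z j‖ ^ 2 := by
  have hn0 : (0 : ℝ) < n := by exact_mod_cast hn
  have hsub : ∑ j ∈ range i, ‖z j‖ ≤ ∑ j ∈ range n, ‖z j‖ :=
    sum_le_sum_of_subset_of_nonneg (range_mono hi) fun _ _ _ => norm_nonneg _
  have hcs := sq_sum_le_card_mul_sum_sq (s := range n) (f := fun j => ‖z j‖)
  rw [card_range] at hcs
  rw [norm_smul, mul_pow, Real.norm_eq_abs, sq_abs]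
  calc (n : ℝ)⁻¹ ^ 2 * ‖∑ j ∈ range i, z j‖ ^ 2
      ≤ (n : ℝ)⁻¹ ^ 2 * (n * ∑ j ∈ range n, ‖z j‖ ^ 2) := by
        gcongr
        refine le_trans ?_ hcs
        gcongr
        exact (norm_sum_le _ _).trans hsub
    _ = (n : ℝ)⁻¹ * ∑ j ∈ range n, ‖z j‖ ^ 2 := by field_simp

/-- The average squared deviation is smallest around the mean. -/
theorem average_norm_sq_sub_mean_le {n : ℕ} (hn : 1 ≤ n) (z : ℕ → E) (M c : E)
    (hM : M = (n : ℝ)⁻¹ • ∑ j ∈ range n, z j) :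
    (n : ℝ)⁻¹ * ∑ j ∈ range n, ‖z j - M‖ ^ 2 ≤ (n : ℝ)⁻¹ * ∑ j ∈ range n, ‖z j - c‖ ^ 2 := by
  have hn0 : (n : ℝ) ≠ 0 := by positivity
  have hsum : ∑ j ∈ range n, z j = (n : ℝ) • M := by rw [hM, smul_inv_smul₀ hn0]
  have hexpand : ∀ j, ‖z j - c‖ ^ 2
      = ‖z j - M‖ ^ 2 + (2 * inner ℝ (z j - M) (M - c) + ‖M - c‖ ^ 2) := by
    intro j
    have hadd := norm_add_sq_real (z j - M) (M - c)
    rw [sub_add_sub_cancel] at hadd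
    linarith
  have hcross : ∑ j ∈ range n, (z j - M) = 0 := by
    rw [sum_sub_distrib, hsum, sum_const, card_range, Nat.cast_smul_eq_nsmul, sub_self]
  gcongr (n : ℝ)⁻¹ * ?_
  simp_rw [hexpand]
  rw [sum_add_distrib, sum_add_distrib, ← mul_sum, ← sum_inner, hcross, inner_zero_left]
  have : 0 ≤ ∑ _j ∈ range n, ‖M - c‖ ^ 2 := sum_nonneg fun _ _ => by positivity
  linarith

theorem norm_sq_add_le_two_mul (a b : E) : ‖a + b‖ ^ 2 ≤ 2 * (‖a‖ ^ 2 + ‖b‖ ^ 2) := by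
  have hpar := parallelogram_law_with_norm ℝ a b
  nlinarith [sq_nonneg ‖a - b‖]

end Averages

section Epoch

variable {E : Type*} [NormedAddCommGroup E] [InnerProductSpace ℝ E]

/-- Closed form of the inner iterates of one epoch, in terms of the averaged step `u`. -/
theorem epoch_iterate_eq {n : ℕ} (hn : 1 ≤ n) {η β : ℝ} {x g : ℕ → E} {m M u : E}
    (hx : ∀ i < n, x (i + 1) = x i - (η / n) • (β • m + (1 - β) • g i))
    (hu : u = β • m + (1 - β) • M) (i : ℕ) (hi : i ≤ n) :
    x i = x 0 - η • (((i : ℝ) / n) • u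
      + (1 - β) • ((n : ℝ)⁻¹ • ∑ j ∈ range i, (g j - M))) := by
  have hn0 : (n : ℝ) ≠ 0 := by positivity
  induction i with
  | zero => simp
  | succ i ih =>
    rw [hx i hi, ih (by omega), sum_range_succ, hu]
    push_cast
    simp only [div_eq_mul_inv]
    module

/-- Both endpoints of an epoch are close to all of its inner iterates. -/
theorem epoch_norm_sq_sub_le {n : ℕ} (hn : 1 ≤ n) {η β : ℝ} {x g : ℕ → E} {m M u : E}
    (hx : ∀ i < n, x (i + 1) = x i - (η / n) • (β • m + (1 - β) • g i))
    (hM : M = (n : ℝ)⁻¹ • ∑ j ∈ range n, g j)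
    (hu : u = β • m + (1 - β) • M) (i : ℕ) (hi : i ≤ n) (y : E) (hy : y = x 0 ∨ y = x n) :
    ‖x i - y‖ ^ 2 ≤ 2 * η ^ 2 * (‖u‖ ^ 2
      + (1 - β) ^ 2 * ((n : ℝ)⁻¹ * ∑ j ∈ range n, ‖g j - M‖ ^ 2)) := by
  have hn0 : (0 : ℝ) < n := by positivity
  have hcross : ∑ j ∈ range n, (g j - M) = 0 := by
    rw [sum_sub_distrib, sum_const, card_range, hM, ← Nat.cast_smul_eq_nsmul ℝ,
      smul_inv_smul₀ hn0.ne', sub_self]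
  have hS := norm_sq_partial_average_le hn hi (fun j => g j - M)
  set S := (n : ℝ)⁻¹ • ∑ j ∈ range i, (g j - M) with hSdef
  have hxi := epoch_iterate_eq hn hx hu i hi
  have hxn := epoch_iterate_eq hn hx hu n le_rfl
  rw [hcross, smul_zero, smul_zero, add_zero, div_self hn0.ne', one_smul] at hxn
  have hp0 : (0 : ℝ) ≤ (i : ℝ) / n := by positivity
  have hp1 : (i : ℝ) / n ≤ 1 := by
    rw [div_le_one hn0]; exact_mod_cast hi
  obtain ⟨c, hc, hxy⟩ : ∃ c : ℝ, c ^ 2 ≤ 1 ∧ x i - y = (-η) • (c • u + (1 - β) • S) := by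
    rcases hy with rfl | rfl
    · exact ⟨i / n, by nlinarith, by rw [hxi]; module⟩
    · exact ⟨i / n - 1, by nlinarith, by rw [hxi, hxn]; module⟩
  rw [hxy, norm_smul, mul_pow, Real.norm_eq_abs, sq_abs, neg_sq, mul_comm 2 (η ^ 2), mul_assoc]
  gcongr
  refine (norm_sq_add_le_two_mul _ _).trans ?_
  rw [norm_smul, norm_smul, mul_pow, mul_pow, Real.norm_eq_abs, Real.norm_eq_abs, sq_abs, sq_abs]
  gcongr
  exact mul_le_of_le_one_left (by positivity) hc

/-- The mean of the gradients used in an epoch approximates the full gradient at both endpoints. -/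
theorem epoch_gradient_error_le {n : ℕ} (hn : 1 ≤ n) {η β L A : ℝ}
    (hβ0 : 0 ≤ β) (hβ1 : β ≤ 1) (hηL : 45 * (L ^ 2 * η ^ 2) ≤ 1)
    {x g : ℕ → E} {m M u : E} (q : ℕ → E → E) (G : E → E)
    (hq : ∀ j < n, ∀ y z, ‖q j y - q j z‖ ≤ L * ‖y - z‖)
    (hG : ∀ y, G y = (n : ℝ)⁻¹ • ∑ j ∈ range n, q j y)
    (hvar : (n : ℝ)⁻¹ * ∑ j ∈ range n, ‖q j (x 0) - G (x 0)‖ ^ 2 ≤ A)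
    (hg : ∀ j < n, g j = q j (x j))
    (hx : ∀ i < n, x (i + 1) = x i - (η / n) • (β • m + (1 - β) • g i))
    (hM : M = (n : ℝ)⁻¹ • ∑ j ∈ range n, g j)
    (hu : u = β • m + (1 - β) • M) (y : E) (hy : y = x 0 ∨ y = x n) :
    ‖G y - M‖ ^ 2 ≤ 9 / 4 * (L ^ 2 * η ^ 2) * (‖u‖ ^ 2 + 2 * (1 - β) ^ 2 * A) := by
  have hn0 : (0 : ℝ) < n := by positivity
  set V := (n : ℝ)⁻¹ * ∑ j ∈ range n, ‖g j - M‖ ^ 2 with hV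
  set R := 2 * η ^ 2 * (‖u‖ ^ 2 + (1 - β) ^ 2 * V) with hR
  have hdist : ∀ z, (z = x 0 ∨ z = x n) → ∀ j < n, ‖g j - q j z‖ ^ 2 ≤ L ^ 2 * R := by
    intro z hz j hj
    have hxz := epoch_norm_sq_sub_le hn hx hM hu j hj.le z hz
    have hlip := hq j hj (x j) z
    rw [hg j hj]
    calc ‖q j (x j) - q j z‖ ^ 2 ≤ (L * ‖x j - z‖) ^ 2 := by gcongr
      _ = L ^ 2 * ‖x j - z‖ ^ 2 := by ring
      _ ≤ L ^ 2 * R := by gcongr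
  have havg : ∀ z, (z = x 0 ∨ z = x n) →
      (n : ℝ)⁻¹ * ∑ j ∈ range n, ‖g j - q j z‖ ^ 2 ≤ L ^ 2 * R := by
    intro z hz
    have hsum := sum_le_card_nsmul (range n) (fun j => ‖g j - q j z‖ ^ 2) (L ^ 2 * R)
      fun j hj => hdist z hz j (mem_range.1 hj)
    rw [card_range, nsmul_eq_mul] at hsum
    rwa [inv_mul_le_iff₀ hn0]
  have hVle : V ≤ 2 * (L ^ 2 * R) + 2 * A := by
    refine (average_norm_sq_sub_mean_le hn g M (G (x 0)) hM).trans ?_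
    have hsplit : ∀ j, ‖g j - G (x 0)‖ ^ 2
        ≤ 2 * (‖g j - q j (x 0)‖ ^ 2 + ‖q j (x 0) - G (x 0)‖ ^ 2) := fun j => by
      simpa using norm_sq_add_le_two_mul (g j - q j (x 0)) (q j (x 0) - G (x 0))
    have hle : (n : ℝ)⁻¹ * ∑ j ∈ range n, ‖g j - G (x 0)‖ ^ 2
        ≤ (n : ℝ)⁻¹ * ∑ j ∈ range n,
          2 * (‖g j - q j (x 0)‖ ^ 2 + ‖q j (x 0) - G (x 0)‖ ^ 2) := by
      gcongr with j _
      exact hsplit j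
    rw [← mul_sum, sum_add_distrib] at hle
    nlinarith [havg (x 0) (Or.inl rfl)]
  have herr : ‖G y - M‖ ^ 2 ≤ L ^ 2 * R := by
    have hGM : M - G y = (n : ℝ)⁻¹ • ∑ j ∈ range n, (g j - q j y) := by
      rw [hG, hM, sum_sub_distrib, smul_sub]
    rw [norm_sub_rev, hGM]
    exact (norm_sq_partial_average_le hn le_rfl _).trans (havg y hy)
  refine herr.trans ?_
  have hb : (1 - β) ^ 2 ≤ 1 := by nlinarith
  have hV0 : 0 ≤ V := by positivity
  have hR0 : 0 ≤ R := by positivity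
  set c := L ^ 2 * η ^ 2 with hc
  have hc0 : 0 ≤ c := by positivity
  have hLR : L ^ 2 * R = 2 * c * (‖u‖ ^ 2 + (1 - β) ^ 2 * V) := by rw [hR, hc]; ring
  have hQ0 : 0 ≤ L ^ 2 * R := by positivity
  set Q := L ^ 2 * R
  have hbV : (1 - β) ^ 2 * V ≤ (1 - β) ^ 2 * (2 * Q + 2 * A) := by gcongr
  have hbQ : (1 - β) ^ 2 * Q ≤ Q := mul_le_of_le_one_left hQ0 hb
  have hQle : Q ≤ 2 * c * (‖u‖ ^ 2 + 2 * (1 - β) ^ 2 * A) + 4 * (c * Q) := by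
    rw [hLR]
    nlinarith [mul_le_mul_of_nonneg_left (hbV.trans (by linarith :
      (1 - β) ^ 2 * (2 * Q + 2 * A) ≤ 2 * Q + 2 * (1 - β) ^ 2 * A)) hc0]
  have hcQ : 45 * (c * Q) ≤ Q := by nlinarith
  linarith

end Epoch

section Scalars

/-- What the learning-rate bound `η ≤ 1 / (L * √K)` gives for `L ^ 2 * η ^ 2`. -/
theorem learning_rate_bound {L η β Θ K : ℝ} (hL : 0 < L) (hη : 0 < η) (hβ0 : 0 ≤ β)
    (hβ1 : β < 1) (hΘ : 0 ≤ Θ)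
    (hK : K = max (5 / 2) (9 * (5 - 3 * β) * (Θ + 1) / (1 - β)))
    (hηK : η ≤ 1 / (L * Real.sqrt K)) :
    45 * (L ^ 2 * η ^ 2) ≤ 1 ∧ 18 * (Θ + 1) * (L ^ 2 * η ^ 2) ≤ 1 - β := by
  have hb : 0 < 1 - β := by linarith
  have hK0 : 0 < K := by
    rw [hK]; exact lt_of_lt_of_le (by norm_num) (le_max_left _ _)
  have hKge : 9 * (5 - 3 * β) * (Θ + 1) ≤ K * (1 - β) := by
    rw [← div_le_iff₀ hb, hK]; exact le_max_right _ _
  have hs : 0 < Real.sqrt K := Real.sqrt_pos.2 hK0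
  rw [le_div_iff₀ (by positivity)] at hηK
  have hsq : (η * (L * Real.sqrt K)) ^ 2 ≤ 1 := pow_le_one₀ (by positivity) hηK
  have hcK : L ^ 2 * η ^ 2 * K ≤ 1 := by
    calc L ^ 2 * η ^ 2 * K = (η * (L * Real.sqrt K)) ^ 2 := by
          rw [mul_pow, mul_pow, Real.sq_sqrt hK0.le]; ring
      _ ≤ 1 := hsq
  have hc0 : 0 ≤ L ^ 2 * η ^ 2 := by positivity
  set c := L ^ 2 * η ^ 2
  have hmain : c * (9 * (5 - 3 * β) * (Θ + 1)) ≤ 1 - β := by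
    nlinarith [mul_le_mul_of_nonneg_left hKge hc0]
  have hcΘ : 0 ≤ c * Θ := by positivity
  constructor
  · have : 45 * c * (1 - β) ≤ 1 * (1 - β) := by
      nlinarith [mul_nonneg hcΘ hb.le, mul_nonneg hc0 hβ0]
    exact le_of_mul_le_mul_right this hb
  · nlinarith [mul_nonneg hcΘ hb.le, mul_nonneg hc0 hb.le]

/-- The gradient error of an epoch is absorbed by the descent terms, up to the variance. -/
theorem epoch_error_absorb {L η β Θ σ U G : ℝ} (hη : 0 ≤ η) (hβ0 : 0 ≤ β)
    (hβ1 : β ≤ 1) (hU : 0 ≤ U) (hG : 0 ≤ G) (hΘ : 0 ≤ Θ)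
    (hc : 45 * (L ^ 2 * η ^ 2) ≤ 1) (hcΘ : 18 * (Θ + 1) * (L ^ 2 * η ^ 2) ≤ 1 - β) :
    η / 2 * (9 / 4 * (L ^ 2 * η ^ 2) * (U + 2 * (1 - β) ^ 2 * (Θ * G + σ ^ 2)))
      ≤ η / 2 * (1 - L * η) * U + (1 - β) / 8 * η * G
        + 9 / 4 * (1 - β) ^ 2 * L ^ 2 * σ ^ 2 * η ^ 3 := by
  have hLη : L * η ≤ 1 / 2 := by
    refine le_of_sq_le_sq ?_ (by norm_num)
    rw [mul_pow]; linarith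
  have hcoefU : 9 / 4 * (L ^ 2 * η ^ 2) ≤ 1 - L * η := by linarith
  have hb : (1 - β) ^ 2 ≤ 1 := by nlinarith
  have hc0 : 0 ≤ L ^ 2 * η ^ 2 := by positivity
  have hcoefG : 9 / 2 * (L ^ 2 * η ^ 2) * (1 - β) ^ 2 * Θ ≤ (1 - β) / 4 := by
    have : (L ^ 2 * η ^ 2 * Θ) * (1 - β) ^ 2 ≤ L ^ 2 * η ^ 2 * Θ :=
      mul_le_of_le_one_right (by positivity) hb
    nlinarith
  have hmulU := mul_le_mul_of_nonneg_left (mul_le_mul_of_nonneg_right hcoefU hU) hη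
  have hmulG := mul_le_mul_of_nonneg_left (mul_le_mul_of_nonneg_right hcoefG hG) hη
  nlinarith

/-- Telescoping of a descent inequality whose error term is delayed by one step. -/
theorem telescope_delayed_error {T : ℕ} {β b : ℝ} (hβ0 : 0 ≤ β)
    {φ η G U P D : ℕ → ℝ} (hη : ∀ t, 1 ≤ t → t ≤ T → 0 ≤ η t)
    (hanti : ∀ t, 1 ≤ t → t + 1 ≤ T → η (t + 1) ≤ η t)
    (hG : ∀ t, 0 ≤ G t) (hP : ∀ t, 0 ≤ P t)
    (hfirst : 1 ≤ T → φ 1 ≤ φ 0 - η 1 / 2 * G 1 - U 1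
      + η 1 / 2 * (β * G 1 + (1 - β) * P 1))
    (hstep : ∀ t, 1 ≤ t → t + 1 ≤ T → φ (t + 1) ≤ φ t - η (t + 1) / 2 * G (t + 1) - U (t + 1)
      + η (t + 1) / 2 * (β * P t + (1 - β) * P (t + 1)))
    (habsorb : ∀ t, 1 ≤ t → t ≤ T →
      η t / 2 * P t ≤ U t + (1 - β) / 8 * η t * G t + b * η t ^ 3)
    (hD : ∀ t, D t = 3 / 8 * (1 - β) * (η t * G t) - b * η t ^ 3) (hT : 1 ≤ T) :
    φ T + ∑ t ∈ Icc 1 T, D t ≤ φ 0 := by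
  have key : ∀ t, 1 ≤ t → t ≤ T →
      φ t + η t / 2 * β * P t + ∑ s ∈ Icc 1 t, D s ≤ φ 0 := by
    intro t ht
    induction t, ht using Nat.le_induction with
    | base =>
      intro h
      rw [Icc_self, sum_singleton, hD]
      linarith [hfirst h, habsorb 1 le_rfl h]
    | succ t ht ih =>
      intro h
      rw [sum_Icc_succ_top (by omega), hD (t + 1)]
      have hdelay : η (t + 1) / 2 * (β * P t) ≤ η t / 2 * (β * P t) :=
        mul_le_mul_of_nonneg_right (by linarith [hanti t ht h]) (mul_nonneg hβ0 (hP t))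
      have hηG : 0 ≤ η (t + 1) * G (t + 1) := mul_nonneg (hη _ (by omega) h) (hG _)
      nlinarith [ih (by omega), hstep t ht h, habsorb (t + 1) (by omega) h,
        mul_nonneg hβ0 hηG]
  have hlast : 0 ≤ η T / 2 * β * P T :=
    mul_nonneg (mul_nonneg (by linarith [hη T hT le_rfl]) hβ0) (hP T)
  linarith [key T hT le_rfl]

/-- Bounds on the exponential learning-rate schedule. -/
theorem exponential_schedule_bounds {T : ℕ} (hT : 1 ≤ T) {γ ρ α : ℝ} (hγ : 0 < γ) (hρ0 : 0 < ρ)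
    (hρ1 : ρ < 1) (hα : α = ρ ^ ((1 : ℝ) / (T : ℝ))) {η : ℕ → ℝ}
    (hη : ∀ t, 1 ≤ t → t ≤ T → η t = γ * α ^ t / (T : ℝ) ^ ((1 : ℝ) / 3)) :
    (∀ t, 1 ≤ t → t + 1 ≤ T → η (t + 1) ≤ η t) ∧
    ∑ t ∈ Icc 1 T, η t ^ 3 ≤ γ ^ 3 ∧
    γ * ρ * (T : ℝ) ^ ((2 : ℝ) / 3) ≤ ∑ t ∈ Icc 1 T, η t := by
  have hT0 : (0 : ℝ) < T := by positivity
  have hα0 : 0 < α := by rw [hα]; positivity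
  have hα1 : α ≤ 1 := by
    rw [hα]; exact Real.rpow_le_one hρ0.le hρ1.le (by positivity)
  have hαT : α ^ T = ρ := by
    rw [hα, ← Real.rpow_natCast, ← Real.rpow_mul hρ0.le, one_div_mul_cancel hT0.ne', Real.rpow_one]
  have hr0 : 0 < (T : ℝ) ^ ((1 : ℝ) / 3) := by positivity
  have hr3 : ((T : ℝ) ^ ((1 : ℝ) / 3)) ^ 3 = T := by
    rw [← Real.rpow_natCast, ← Real.rpow_mul hT0.le]; norm_num
  have hr2 : (T : ℝ) ^ ((2 : ℝ) / 3) = ((T : ℝ) ^ ((1 : ℝ) / 3)) ^ 2 := by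
    rw [← Real.rpow_natCast, ← Real.rpow_mul hT0.le]; norm_num
  refine ⟨fun t ht h => ?_, ?_, ?_⟩
  · rw [hη t ht (by omega), hη (t + 1) (by omega) h]
    gcongr γ * ?_ / _
    exact pow_le_pow_of_le_one hα0.le hα1 (Nat.le_succ t)
  · have hle : ∀ t ∈ Icc 1 T, η t ^ 3 ≤ γ ^ 3 / T := by
      intro t ht
      rw [mem_Icc] at ht
      rw [hη t ht.1 ht.2, div_pow, hr3]
      gcongr
      exact mul_le_of_le_one_right hγ.le (pow_le_one₀ hα0.le hα1)
    have hsum := sum_le_card_nsmul _ _ _ hle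
    rw [Nat.card_Icc, nsmul_eq_mul, Nat.add_sub_cancel] at hsum
    rwa [mul_div_cancel₀ _ hT0.ne'] at hsum
  · have hge : ∀ t ∈ Icc 1 T, γ * ρ / (T : ℝ) ^ ((1 : ℝ) / 3) ≤ η t := by
      intro t ht
      rw [mem_Icc] at ht
      rw [hη t ht.1 ht.2, ← hαT]
      gcongr γ * ?_ / _
      exact pow_le_pow_of_le_one hα0.le hα1 ht.2
    have hsum := card_nsmul_le_sum _ _ _ hge
    rw [Nat.card_Icc, nsmul_eq_mul, Nat.add_sub_cancel] at hsum
    refine le_trans (le_of_eq ?_) hsum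
    rw [hr2]
    nth_rewrite 2 [← hr3]
    field_simp

end Scalars

theorem smg_exponential_lr
    (n d : ℕ) (hn : 1 ≤ n) (hd : 1 ≤ d)
    (f : Fin n → EuclideanSpace ℝ (Fin d) → ℝ)
    (hf : ∀ i, Differentiable ℝ (f i))
    (F : EuclideanSpace ℝ (Fin d) → ℝ)
    (hF : F = fun x => (1 / (n : ℝ)) * ∑ i, f i x)
    (L : ℝ) (hL : 0 < L)
    (hsmooth : ∀ i x y, ‖gradient (f i) x - gradient (f i) y‖ ≤ L * ‖x - y‖)
    (Θ σ : ℝ) (hΘ : 0 ≤ Θ) (hσ : 0 ≤ σ)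
    (hvar : ∀ x, (1 / (n : ℝ)) * ∑ i, ‖gradient (f i) x - gradient F x‖ ^ 2
        ≤ Θ * ‖gradient F x‖ ^ 2 + σ ^ 2)
    (Fstar : ℝ) (hFstar : IsGLB (Set.range F) Fstar)
    (T : ℕ) (hT : 1 ≤ T)
    (β : ℝ) (hβ0 : 0 ≤ β) (hβ1 : β < 1)
    (η : ℕ → ℝ) (hηpos : ∀ t, 1 ≤ t → t ≤ T → 0 < η t)
    (π : ℕ → Equiv.Perm (Fin n))
    (w m v g : ℕ → ℕ → EuclideanSpace ℝ (Fin d))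
    (wt mt : ℕ → EuclideanSpace ℝ (Fin d))
    (hmt0 : mt 0 = 0)
    (hw0 : ∀ t, 1 ≤ t → t ≤ T → w t 0 = wt (t - 1))
    (hm0 : ∀ t, 1 ≤ t → t ≤ T → m t 0 = mt (t - 1))
    (hv0 : ∀ t, 1 ≤ t → t ≤ T → v t 0 = 0)
    (hg : ∀ t, 1 ≤ t → t ≤ T → ∀ i, ∀ hi : i < n,
        g t i = gradient (f (π t ⟨i, hi⟩)) (w t i))
    (hm1 : ∀ t, 1 ≤ t → t ≤ T → ∀ i, i < n →
        m t (i + 1) = β • m t 0 + (1 - β) • g t i)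
    (hv1 : ∀ t, 1 ≤ t → t ≤ T → ∀ i, i < n →
        v t (i + 1) = v t i + ((n : ℝ))⁻¹ • g t i)
    (hw1 : ∀ t, 1 ≤ t → t ≤ T → ∀ i, i < n →
        w t (i + 1) = w t i - (η t / (n : ℝ)) • m t (i + 1))
    (hwt : ∀ t, 1 ≤ t → t ≤ T → wt t = w t n)
    (hmt : ∀ t, 1 ≤ t → t ≤ T → mt t = v t n)
    (K : ℝ) (hKdef : K = max (5 / 2) (9 * (5 - 3 * β) * (Θ + 1) / (1 - β)))
    (γ ρ : ℝ) (hγ : 0 < γ) (hρ0 : 0 < ρ) (hρ1 : ρ < 1)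
    (α : ℝ) (hα : α = ρ ^ ((1 : ℝ) / (T : ℝ)))
    (hη : ∀ t, 1 ≤ t → t ≤ T → η t = γ * α ^ t / (T : ℝ) ^ ((1 : ℝ) / 3))
    (hηK : ∀ t, 1 ≤ t → t ≤ T → η t ≤ 1 / (L * Real.sqrt K)) :
    (∑ t ∈ Icc 1 T, η t * ‖gradient F (wt (t - 1))‖ ^ 2) / (∑ t ∈ Icc 1 T, η t)
      ≤ 4 * (F (wt 0) - Fstar) / ((1 - β) * γ * ρ * (T : ℝ) ^ ((2 : ℝ) / 3))
        + 9 * σ ^ 2 * L ^ 2 * (5 - 3 * β) * γ ^ 2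
          / ((1 - β) * ρ * (T : ℝ) ^ ((2 : ℝ) / 3)) := by
  have hn0 : (0 : ℝ) < n := by positivity
  obtain ⟨hanti, hcube, hsumη⟩ := exponential_schedule_bounds hT hγ hρ0 hρ1 hα hη
  have hFgrad : ∀ x, HasGradientAt F ((n : ℝ)⁻¹ • ∑ i, gradient (f i) x) x := by
    intro x
    rw [hasGradientAt_iff_hasFDerivAt, hF, one_div, map_smul, map_sum]
    exact (HasFDerivAt.fun_sum fun i _ => (hf i x).hasGradientAt.hasFDerivAt).const_mul _
  have hFdiff : Differentiable ℝ F := fun x => (hFgrad x).differentiableAt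
  have hFlip : ∀ x y, ‖gradient F x - gradient F y‖ ≤ L * ‖x - y‖ := by
    intro x y
    rw [(hFgrad x).gradient, (hFgrad y).gradient, ← smul_sub, ← sum_sub_distrib, norm_smul,
      norm_inv, Real.norm_natCast, inv_mul_le_iff₀ hn0]
    refine (norm_sum_le_of_le _ fun i _ => hsmooth i x y).trans (le_of_eq ?_)
    simp
  have hMt : ∀ t, 1 ≤ t → t ≤ T → mt t = (n : ℝ)⁻¹ • ∑ j ∈ range n, g t j := by
    intro t h1 h2
    have hv : ∀ i ≤ n, v t i = (n : ℝ)⁻¹ • ∑ j ∈ range i, g t j := by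
      intro i
      induction i with
      | zero => simp [hv0 t h1 h2]
      | succ i ih =>
        intro hi
        rw [hv1 t h1 h2 i hi, ih (by omega), sum_range_succ, smul_add]
    rw [hmt t h1 h2, hv n le_rfl]
  let u : ℕ → EuclideanSpace ℝ (Fin d) := fun t => β • mt (t - 1) + (1 - β) • mt t
  let P : ℕ → ℝ := fun t => 9 / 4 * (L ^ 2 * η t ^ 2)
    * (‖u t‖ ^ 2 + 2 * (1 - β) ^ 2 * (Θ * ‖gradient F (wt (t - 1))‖ ^ 2 + σ ^ 2))
  have hrate := fun t h1 h2 =>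
    learning_rate_bound hL (hηpos t h1 h2) hβ0 hβ1 hΘ hKdef (hηK t h1 h2)
  have hxstep : ∀ t, 1 ≤ t → t ≤ T → ∀ i < n, w t (i + 1)
      = w t i - (η t / n) • (β • mt (t - 1) + (1 - β) • g t i) := by
    intro t h1 h2 i hi
    rw [hw1 t h1 h2 i hi, hm1 t h1 h2 i hi, hm0 t h1 h2]
  have herror : ∀ t, 1 ≤ t → t ≤ T → ∀ y, (y = w t 0 ∨ y = w t n) →
      ‖gradient F y - mt t‖ ^ 2 ≤ P t := by
    intro t h1 h2 y hy
    let q : ℕ → EuclideanSpace ℝ (Fin d) → EuclideanSpace ℝ (Fin d) := fun j x =>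
      if h : j < n then gradient (f (π t ⟨j, h⟩)) x else 0
    refine epoch_gradient_error_le hn hβ0 hβ1.le (hrate t h1 h2).1 q (gradient F)
      ?_ ?_ ?_ ?_ (hxstep t h1 h2) (hMt t h1 h2) rfl y hy
    · intro j hj y z
      simpa [q, hj] using hsmooth (π t ⟨j, hj⟩) y z
    · intro y
      rw [(hFgrad y).gradient, sum_range, ← Equiv.sum_comp (π t)]
      simp [q]
    · have hv := hvar (w t 0)
      rw [one_div, ← Equiv.sum_comp (π t)] at hv
      rw [sum_range, ← hw0 t h1 h2]
      simpa [q] using hv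
    · intro j hj
      simpa [q, hj] using hg t h1 h2 j hj
  have hwstep : ∀ t, 1 ≤ t → t ≤ T → wt t = wt (t - 1) - η t • u t := by
    intro t h1 h2
    have hcross : ∑ j ∈ range n, (g t j - mt t) = 0 := by
      rw [sum_sub_distrib, sum_const, card_range, hMt t h1 h2, ← Nat.cast_smul_eq_nsmul ℝ,
        smul_inv_smul₀ hn0.ne', sub_self]
    have hend := epoch_iterate_eq hn (hxstep t h1 h2) (rfl : u t = _) n le_rfl
    rwa [hcross, smul_zero, smul_zero, add_zero, div_self hn0.ne', one_smul, ← hwt t h1 h2,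
      hw0 t h1 h2] at hend
  have hdescent : ∀ t, 1 ≤ t → t ≤ T → F (wt t) ≤ F (wt (t - 1))
      - η t / 2 * ‖gradient F (wt (t - 1))‖ ^ 2 - η t / 2 * (1 - L * η t) * ‖u t‖ ^ 2
      + η t / 2 * (β * ‖gradient F (wt (t - 1)) - mt (t - 1)‖ ^ 2 + (1 - β) * P t) := by
    intro t h1 h2
    have hη0 := (hηpos t h1 h2).le
    have hb : 0 ≤ 1 - β := by linarith
    have hstep := descent_convex_combination hFdiff hFlip hη0 hβ0 hβ1.le
      (wt (t - 1)) (mt (t - 1)) (mt t) (u t) rfl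
    rw [← hwstep t h1 h2] at hstep
    refine hstep.trans ?_
    gcongr
    exact herror t h1 h2 _ (Or.inl (hw0 t h1 h2).symm)
  have htele := telescope_delayed_error (T := T) (b := 9 / 4 * (1 - β) ^ 2 * L ^ 2 * σ ^ 2) hβ0
    (φ := fun t => F (wt t)) (η := η) (G := fun t => ‖gradient F (wt (t - 1))‖ ^ 2)
    (U := fun t => η t / 2 * (1 - L * η t) * ‖u t‖ ^ 2) (P := P)
    (fun t h1 h2 => (hηpos t h1 h2).le) hanti (fun t => by positivity)
    (fun t => by positivity)
    (fun h => by simpa [hmt0] using hdescent 1 le_rfl h)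
    (fun t h1 h2 => by
      have hη0 := (hηpos (t + 1) (by omega) h2).le
      refine (hdescent (t + 1) (by omega) h2).trans ?_
      simp only [Nat.add_sub_cancel]
      gcongr
      exact herror t h1 (by omega) _ (Or.inr (hwt t h1 (by omega))))
    (fun t h1 h2 => epoch_error_absorb (hηpos t h1 h2).le hβ0 hβ1.le (by positivity)
      (by positivity) hΘ (hrate t h1 h2).1 (hrate t h1 h2).2)
    (fun t => rfl) hT
  rw [sum_sub_distrib, ← mul_sum, ← mul_sum] at htele
  have hlow : Fstar ≤ F (wt T) := hFstar.1 (Set.mem_range_self _)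
  have hlow0 : Fstar ≤ F (wt 0) := hFstar.1 (Set.mem_range_self _)
  have hb : 0 < 1 - β := by linarith
  have hr : 0 < (T : ℝ) ^ ((2 : ℝ) / 3) := by positivity
  have hden : 0 < γ * ρ * (T : ℝ) ^ ((2 : ℝ) / 3) := by positivity
  set N := ∑ t ∈ Icc 1 T, η t * ‖gradient F (wt (t - 1))‖ ^ 2
  have hN0 : 0 ≤ N := sum_nonneg fun t ht => by
    rw [mem_Icc] at ht
    exact mul_nonneg (hηpos t ht.1 ht.2).le (by positivity)
  have hvarγ : 9 / 4 * (1 - β) ^ 2 * L ^ 2 * σ ^ 2 * ∑ t ∈ Icc 1 T, η t ^ 3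
      ≤ 9 / 4 * (1 - β) ^ 2 * L ^ 2 * σ ^ 2 * γ ^ 3 := by gcongr
  have hcoef : 9 / 4 * (1 - β) ^ 2 ≤ 27 / 8 * (5 - 3 * β) := by nlinarith
  have hcoefγ := mul_le_mul_of_nonneg_right hcoef (by positivity : 0 ≤ L ^ 2 * σ ^ 2 * γ ^ 3)
  have hNle : N * (1 - β)
      ≤ 4 * (F (wt 0) - Fstar) + 9 * σ ^ 2 * L ^ 2 * (5 - 3 * β) * γ ^ 3 := by linarith
  calc N / ∑ t ∈ Icc 1 T, η t ≤ N / (γ * ρ * (T : ℝ) ^ ((2 : ℝ) / 3)) := by gcongr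
    _ ≤ ((4 * (F (wt 0) - Fstar) + 9 * σ ^ 2 * L ^ 2 * (5 - 3 * β) * γ ^ 3) / (1 - β))
        / (γ * ρ * (T : ℝ) ^ ((2 : ℝ) / 3)) := by
        gcongr
        rwa [le_div_iff₀ hb]
    _ = _ := by field_simp
end
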